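/- Let φ(t) = (2/3)t^{3/2}, let β ∈ C_c^∞(ℝ) with support contained in [1/4, 2], and let a : [0,∞)×(0,∞) → ℂ be smooth in ρ with |∂_ρ^k a(t,ρ)| ≤ C_k (1+φ(t)ρ)^{−1/6} ρ^{−k} for all k ≥ 0. Set α(t,ρ) = ρ β(ρ) a(t,ρ) and α̂_t(ξ) = ∫₀^∞ e^{−iρξ} α(t,ρ) dρ. Then there exists a constant C > 0, independent of b ∈ ℝ, r and t ≥ 0, such that for all r > 1 and |b| ≤ 2r, ∫₀^{2π} |α̂_t(b − r cosθ)| dθ ≤ C ( r^{−1} + r^{−1/2} (1 + |r − |b||)^{−1/2} ) (1+φ(t))^{−1/6}. -/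

import Mathlib

open MeasureTheory Set

/-- `φ(t) = (2/3) t^{3/2}`, the characteristic function of the Tricomi operator. -/
noncomputable def phi (t : ℝ) : ℝ := (2 / 3) * t ^ ((3 : ℝ) / 2)

/-- The localized amplitude `α(t,ρ) = ρ β(ρ) a(t,ρ)`. -/
noncomputable def alphaAmp (β : ℝ → ℝ) (a : ℝ → ℝ → ℂ) (t ρ : ℝ) : ℂ :=
  ((ρ * β ρ : ℝ) : ℂ) * a t ρ

/-- The one-dimensional Fourier transform `α̂_t(ξ) = ∫₀^∞ e^{-iρξ} α(t,ρ) dρ` of the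
localized amplitude in the frequency-modulus variable `ρ`. -/
noncomputable def alphaHat (β : ℝ → ℝ) (a : ℝ → ℝ → ℂ) (t ξ : ℝ) : ℂ :=
  ∫ ρ in Ioi (0 : ℝ), Complex.exp (-(Complex.I * ρ * ξ)) * alphaAmp β a t ρ


lemma cauchy_aux (w : ℂ) (hw : 1 < ‖w‖) :
    ∫ θ in (0 : ℝ)..(2 * Real.pi), (w + w⁻¹ - 2 * (Real.cos θ : ℂ))⁻¹
      = 2 * Real.pi * (w - w⁻¹)⁻¹ := by
  have hw0 : w ≠ 0 := by
    rintro rfl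
    simp at hw
    linarith
  have hd : DifferentiableOn ℂ (fun u : ℂ => (w - u)⁻¹) (Metric.closedBall 0 1) := by
    apply DifferentiableOn.inv (by fun_prop)
    intro u hu h
    have : w = u := by linear_combination h
    simp at hu
    rw [this] at hw
    linarith
  have hin : w⁻¹ ∈ Metric.ball (0 : ℂ) 1 := by
    simp only [mem_ball_zero_iff, norm_inv]
    exact inv_lt_one_of_one_lt₀ hw
  have h := hd.circleIntegral_sub_inv_smul hin
  rw [circleIntegral] at h
  have hI : Complex.I ≠ 0 := Complex.I_ne_zero
  have key : ∀ θ : ℝ, deriv (circleMap 0 1) θ •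
      ((circleMap 0 1 θ - w⁻¹)⁻¹ • (fun u : ℂ => (w - u)⁻¹) (circleMap 0 1 θ))
      = Complex.I * (w + w⁻¹ - 2 * (Real.cos θ : ℂ))⁻¹ := by
    intro θ
    set u := circleMap 0 1 θ with hu
    have hun : ‖u‖ = 1 := by simp [hu]
    have hu0 : u ≠ 0 := by
      intro h
      simp [h] at hun
    have hcos : 2 * (Real.cos θ : ℂ) = u + u⁻¹ := by
      rw [hu, circleMap, Complex.ofReal_cos, Complex.two_cos]
      simp [← Complex.exp_neg]
    have h1 : w - u ≠ 0 := by
      intro h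
      have : w = u := by linear_combination h
      rw [this] at hw
      linarith
    have h2 : u - w⁻¹ ≠ 0 := by
      intro h
      have : u = w⁻¹ := by linear_combination h
      rw [this, norm_inv] at hun
      have := inv_lt_one_of_one_lt₀ hw
      linarith
    have hfac : w + w⁻¹ - (u + u⁻¹) = (w - u) * (u - w⁻¹) * u⁻¹ := by
      field_simp
      ring
    rw [hcos, hfac, deriv_circleMap, ← hu]
    simp only [smul_eq_mul, mul_inv, inv_inv]
    ring
  simp_rw [key] at h
  rw [intervalIntegral.integral_const_mul] at h
  simp only [smul_eq_mul] at h
  apply mul_left_cancel₀ hI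
  rw [h]
  ring

lemma joukowski_aux (c : ℂ) (hc : c.im ≠ 0) : ∃ w : ℂ, 1 < ‖w‖ ∧ w + w⁻¹ = 2 * c := by
  obtain ⟨s, hs⟩ := IsAlgClosed.exists_pow_nat_eq (c ^ 2 - 1) (n := 2) (by norm_num)
  have hmul : (c + s) * (c - s) = 1 := by linear_combination -hs
  have hne : ∀ w : ℂ, w + w⁻¹ = 2 * c → ‖w‖ ≠ 1 := by
    intro w h h1
    rw [Complex.inv_eq_conj h1, Complex.add_conj] at h
    have := congrArg Complex.im h
    simp at this
    exact hc this
  have e1 : (c + s)⁻¹ = c - s := inv_eq_of_mul_eq_one_right hmul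
  have e2 : (c - s)⁻¹ = c + s := by rw [← e1, inv_inv]
  have w1 : (c + s) + (c + s)⁻¹ = 2 * c := by rw [e1]; ring
  have w2 : (c - s) + (c - s)⁻¹ = 2 * c := by rw [e2]; ring
  rcases lt_trichotomy ‖c + s‖ 1 with h | h | h
  · refine ⟨c - s, ?_, w2⟩
    have h3 : ‖c + s‖ * ‖c - s‖ = 1 := by rw [← norm_mul, hmul, norm_one]
    by_contra! h4
    nlinarith [norm_nonneg (c + s), norm_nonneg (c - s)]
  · exact absurd h (hne _ w1)
  · exact ⟨_, h, w1⟩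

lemma circ_int_bound (b r : ℝ) (hr : 1 < r) :
    ∫ θ in (0 : ℝ)..(2 * Real.pi), (1 + (b - r * Real.cos θ) ^ 2)⁻¹
      ≤ 2 * Real.pi * Real.sqrt 2 * (r ^ (-(1 : ℝ) / 2) * (1 + abs (r - abs b)) ^ (-(1 : ℝ) / 2)) := by
  have hr0 : (r : ℂ) ≠ 0 := by
    exact_mod_cast (by linarith : r ≠ 0)
  set z : ℂ := b - Complex.I with hz
  obtain ⟨w, hw, hwc⟩ := joukowski_aux (z / r) (by
    rw [Complex.div_ofReal_im]
    simp [hz]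
    linarith)
  have hw0 : w ≠ 0 := by
    rintro rfl
    simp at hw
    linarith
  have hA := cauchy_aux w hw
  have hzne : ∀ θ : ℝ, z - r * (Real.cos θ : ℂ) ≠ 0 := by
    intro θ h
    have := congrArg Complex.im h
    simp [hz, -Complex.ofReal_cos] at this
  have h1 : ∀ θ : ℝ, (1 + (b - r * Real.cos θ) ^ 2)⁻¹ = ((z - r * (Real.cos θ : ℂ))⁻¹).im := by
    intro θ
    rw [Complex.inv_im]
    simp [hz, Complex.normSq_apply, -Complex.ofReal_cos]
    ring
  have h2 : ∀ θ : ℝ, (w + w⁻¹ - 2 * (Real.cos θ : ℂ))⁻¹ = (r / 2) * (z - r * (Real.cos θ : ℂ))⁻¹ := by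
    intro θ
    rw [hwc]
    have : 2 * (z / r) - 2 * (Real.cos θ : ℂ) = (2 / r) * (z - r * (Real.cos θ : ℂ)) := by
      field_simp
    rw [this, mul_inv, inv_div]
  simp_rw [h2] at hA
  rw [intervalIntegral.integral_const_mul] at hA
  set J := ∫ θ in (0 : ℝ)..(2 * Real.pi), (z - r * (Real.cos θ : ℂ))⁻¹ with hJ
  have hcont : Continuous fun θ : ℝ => (z - r * (Real.cos θ : ℂ))⁻¹ :=
    Continuous.inv₀ (by fun_prop) hzne
  have h3 : ∫ θ in (0 : ℝ)..(2 * Real.pi), (1 + (b - r * Real.cos θ) ^ 2)⁻¹ = J.im := by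
    simp_rw [h1]
    have := Complex.imCLM.intervalIntegral_comp_comm (hcont.intervalIntegrable (μ := volume) 0 (2 * Real.pi))
    exact this
  rw [h3]
  have h4 : J ^ 2 * (z ^ 2 - r ^ 2) = (2 * Real.pi) ^ 2 := by
    have hne : w - w⁻¹ ≠ 0 := by
      intro h
      have h5 : w = w⁻¹ := by linear_combination h
      have h6 := congrArg norm h5
      rw [norm_inv] at h6
      have := inv_lt_one_of_one_lt₀ hw
      linarith
    have hJ2 : J * (r / 2 * (w - w⁻¹)) = 2 * Real.pi := by
      have : r / 2 * J * (w - w⁻¹) = 2 * Real.pi := by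
        rw [hA, mul_assoc, inv_mul_cancel₀ hne, mul_one]
      linear_combination this
    have hzz : z ^ 2 - r ^ 2 = (r / 2 * (w - w⁻¹)) ^ 2 := by
      have : z = r / 2 * (w + w⁻¹) := by
        rw [hwc]
        field_simp
      rw [this]
      field_simp
      ring
    rw [hzz, ← mul_pow, hJ2]
  set δ := abs (r - abs b) with hδ
  have hδ0 : 0 ≤ δ := abs_nonneg _
  have hN : r * (1 + δ) / Real.sqrt 2 ≤ ‖z ^ 2 - (r : ℂ) ^ 2‖ := by
    have e : ‖z ^ 2 - (r : ℂ) ^ 2‖ ^ 2 = (1 + (|b| - r) ^ 2) * (1 + (|b| + r) ^ 2) := by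
      rw [← Complex.normSq_eq_norm_sq, Complex.normSq_apply]
      simp [hz, pow_two]
      nlinarith [abs_mul_abs_self b]
    refine (sq_le_sq₀ (by positivity) (norm_nonneg _)).1 ?_
    rw [e, div_pow, Real.sq_sqrt (by norm_num)]
    have e2 : δ ^ 2 = (|b| - r) ^ 2 := by rw [hδ, sq_abs]; ring
    rw [← e2]
    have e3 : r ^ 2 ≤ 1 + (|b| + r) ^ 2 := by nlinarith [abs_nonneg b]
    have e4 : (1 + δ) ^ 2 / 2 ≤ 1 + δ ^ 2 := by nlinarith [sq_nonneg (1 - δ)]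
    calc (r * (1 + δ)) ^ 2 / 2 = (1 + δ) ^ 2 / 2 * r ^ 2 := by ring
      _ ≤ _ := by gcongr
  have h5 : ‖J‖ ^ 2 * ‖z ^ 2 - (r : ℂ) ^ 2‖ = (2 * Real.pi) ^ 2 := by
    rw [← norm_pow, ← norm_mul, h4, norm_pow]
    simp [abs_of_pos Real.pi_pos]
  have hs2 : 0 < Real.sqrt 2 := by positivity
  have h6 : ‖J‖ ^ 2 * (r * (1 + δ)) ≤ (2 * Real.pi) ^ 2 * Real.sqrt 2 := by
    rw [← h5]
    rw [div_le_iff₀ hs2] at hN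
    nlinarith [sq_nonneg ‖J‖]
  have hP : 0 < r * (1 + δ) := by positivity
  have hpow : r ^ (-(1 : ℝ) / 2) * (1 + δ) ^ (-(1 : ℝ) / 2) = (Real.sqrt (r * (1 + δ)))⁻¹ := by
    rw [← Real.mul_rpow (by linarith) (by linarith), neg_div, Real.rpow_neg hP.le, Real.sqrt_eq_rpow]
  rw [hpow]
  refine (Complex.im_le_norm J).trans ?_
  rw [← div_eq_mul_inv, le_div_iff₀ (by positivity)]
  refine (sq_le_sq₀ (by positivity) (by positivity)).1 ?_
  rw [mul_pow, Real.sq_sqrt hP.le, mul_pow (2 * Real.pi)]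
  refine h6.trans ?_
  gcongr
  have : 1 ≤ Real.sqrt 2 := by
    rw [Real.one_le_sqrt]; norm_num
  nlinarith

lemma alphaAmp_zero (β : ℝ → ℝ) (hβsupp : Function.support β ⊆ Icc (1 / 4 : ℝ) 2)
    (a : ℝ → ℝ → ℂ) (t : ℝ) : tsupport (alphaAmp β a t) ⊆ Icc (1 / 4 : ℝ) 2 := by
  apply closure_minimal _ isClosed_Icc
  intro ρ hρ
  apply hβsupp
  intro h
  apply hρ
  simp [alphaAmp, h]

lemma alphaAmp_contDiff (β : ℝ → ℝ) (hβ : ContDiff ℝ (⊤ : ℕ∞) β)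
    (hβsupp : Function.support β ⊆ Icc (1 / 4 : ℝ) 2)
    (a : ℝ → ℝ → ℂ) (t : ℝ) (ha : ContDiffOn ℝ (⊤ : ℕ∞) (a t) (Ioi 0)) :
    ContDiff ℝ (⊤ : ℕ∞) (alphaAmp β a t) := by
  rw [contDiff_iff_contDiffAt]
  intro ρ
  by_cases hρ : ρ ∈ tsupport (alphaAmp β a t)
  swap
  · exact contDiffAt_const.congr_of_eventuallyEq (notMem_tsupport_iff_eventuallyEq.1 hρ)
  have h := alphaAmp_zero β hβsupp a t hρ
  have hρ0 : 0 < ρ := by linarith [h.1]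
  have h1 : ContDiffAt ℝ (⊤ : ℕ∞) (a t) ρ := ha.contDiffAt (Ioi_mem_nhds hρ0)
  have h2 : ContDiff ℝ (⊤ : ℕ∞) (fun ρ : ℝ => ((ρ * β ρ : ℝ) : ℂ)) :=
    Complex.ofRealCLM.contDiff.comp (contDiff_id.mul hβ)
  exact h2.contDiffAt.mul h1

lemma phi_nonneg (t : ℝ) (ht : 0 ≤ t) : 0 ≤ phi t := by
  unfold phi
  positivity

lemma alphaAmp_deriv_zero (β : ℝ → ℝ) 
    (hβsupp : Function.support β ⊆ Icc (1 / 4 : ℝ) 2)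
    (a : ℝ → ℝ → ℂ) (t : ℝ) (n : ℕ) (ρ : ℝ) (hρ : ρ ∉ Icc (1 / 4 : ℝ) 2) :
    iteratedDeriv n (alphaAmp β a t) ρ = 0 := by
  have h1 : ρ ∉ Function.support (iteratedFDeriv ℝ n (alphaAmp β a t)) := fun h =>
    hρ (alphaAmp_zero β hβsupp a t (support_iteratedFDeriv_subset n h))
  rw [Function.notMem_support] at h1
  rw [iteratedDeriv, h1]
  rfl

lemma alphaAmp_deriv_bound (β : ℝ → ℝ) (hβ : ContDiff ℝ (⊤ : ℕ∞) β)
    (hβsupp : Function.support β ⊆ Icc (1 / 4 : ℝ) 2)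
    (a : ℝ → ℝ → ℂ) (Ck : ℕ → ℝ)
    (hasm : ∀ t ∈ Ici (0 : ℝ), ContDiffOn ℝ (⊤ : ℕ∞) (a t) (Ioi 0))
    (hab : ∀ k : ℕ, ∀ t ∈ Ici (0 : ℝ), ∀ ρ ∈ Ioi (0 : ℝ),
      ‖iteratedDerivWithin k (a t) (Ioi 0) ρ‖ ≤
        Ck k * (1 + phi t * ρ) ^ (-(1 : ℝ) / 6) * ρ ^ (-(k : ℝ))) (n : ℕ) :
    ∃ M : ℝ, 0 ≤ M ∧ ∀ t, 0 ≤ t → ∀ ρ,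
      ‖iteratedDeriv n (alphaAmp β a t) ρ‖ ≤ M * (1 + phi t) ^ (-(1 : ℝ) / 6) := by
  set g : ℝ → ℂ := fun ρ : ℝ => ((ρ * β ρ : ℝ) : ℂ) with hg
  have hgs : ContDiff ℝ (⊤ : ℕ∞) g :=
    Complex.ofRealCLM.contDiff.comp (contDiff_id.mul hβ)
  have hG : ∀ i : ℕ, ∃ G : ℝ, ∀ ρ ∈ Icc (1 / 4 : ℝ) 2, ‖iteratedDeriv i g ρ‖ ≤ G := by
    intro i
    have hc : Continuous (iteratedDeriv i g) :=
      hgs.continuous_iteratedDeriv i (by exact_mod_cast le_top)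
    exact isCompact_Icc.exists_bound_of_continuousOn hc.continuousOn
  choose G hG using hG
  have hG0 : ∀ i, 0 ≤ G i := fun i =>
    (norm_nonneg _).trans (hG i 1 (by constructor <;> norm_num))
  have hA : ∀ i : ℕ, ∀ t, 0 ≤ t → ∀ ρ ∈ Icc (1 / 4 : ℝ) 2,
      ‖iteratedDerivWithin i (a t) (Ioi 0) ρ‖ ≤
        |Ck i| * 4 * 4 ^ i * (1 + phi t) ^ (-(1 : ℝ) / 6) := by
    intro i t ht ρ hρ
    have hρ0 : 0 < ρ := by linarith [hρ.1]
    have hp := phi_nonneg t ht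
    refine (hab i t ht ρ hρ0).trans ?_
    have e1 : (1 + phi t * ρ) ^ (-(1 : ℝ) / 6) ≤ 4 * (1 + phi t) ^ (-(1 : ℝ) / 6) := by
      have q1 : (1 + phi t * ρ) ^ (-(1 : ℝ) / 6) ≤ ((1 / 4) * (1 + phi t)) ^ (-(1 : ℝ) / 6) := by
        apply Real.rpow_le_rpow_of_nonpos (by positivity) _ (by norm_num)
        nlinarith [hρ.1]
      rw [Real.mul_rpow (by norm_num) (by positivity)] at q1
      have q2 : (1 / 4 : ℝ) ^ (-(1 : ℝ) / 6) ≤ 4 := by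
        rw [one_div, Real.inv_rpow (by norm_num), ← Real.rpow_neg (by norm_num)]
        calc (4 : ℝ) ^ (-(-(1 : ℝ) / 6)) ≤ 4 ^ (1 : ℝ) :=
              Real.rpow_le_rpow_of_exponent_le (by norm_num) (by norm_num)
          _ = 4 := by norm_num
      refine q1.trans ?_
      gcongr
    have e2 : ρ ^ (-(i : ℝ)) ≤ 4 ^ i := by
      rw [Real.rpow_neg hρ0.le, Real.rpow_natCast, ← inv_pow]
      gcongr
      rw [inv_le_comm₀ hρ0 (by norm_num)]
      linarith [hρ.1]
    calc Ck i * (1 + phi t * ρ) ^ (-(1 : ℝ) / 6) * ρ ^ (-(i : ℝ))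
        ≤ |Ck i| * (4 * (1 + phi t) ^ (-(1 : ℝ) / 6)) * 4 ^ i := by
          gcongr
          exact le_abs_self _
      _ = _ := by ring
  refine ⟨∑ i ∈ Finset.range (n + 1), (n.choose i : ℝ) * G i * (|Ck (n - i)| * 4 * 4 ^ (n - i)),
    Finset.sum_nonneg fun i _ => mul_nonneg (mul_nonneg (by positivity) (hG0 i)) (by positivity), ?_⟩
  intro t ht ρ
  have hp := phi_nonneg t ht
  by_cases hρ : ρ ∈ Icc (1 / 4 : ℝ) 2
  swap
  · rw [alphaAmp_deriv_zero β hβsupp a t n ρ hρ, norm_zero]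
    exact mul_nonneg (Finset.sum_nonneg fun i _ =>
      mul_nonneg (mul_nonneg (by positivity) (hG0 i)) (by positivity)) (by positivity)
  have hρ0 : ρ ∈ Ioi (0 : ℝ) := by
    have := hρ.1
    simp only [mem_Ioi]
    linarith
  rw [← iteratedDerivWithin_of_isOpen isOpen_Ioi hρ0,
    ← norm_iteratedFDerivWithin_eq_norm_iteratedDerivWithin]
  have := norm_iteratedFDerivWithin_mul_le (𝕜 := ℝ) (n := n) hgs.contDiffOn (hasm t ht)
    (uniqueDiffOn_Ioi 0) hρ0 (by exact_mod_cast le_top)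
  refine this.trans ?_
  rw [Finset.sum_mul]
  apply Finset.sum_le_sum
  intro i _
  rw [norm_iteratedFDerivWithin_eq_norm_iteratedDerivWithin,
    norm_iteratedFDerivWithin_eq_norm_iteratedDerivWithin,
    iteratedDerivWithin_of_isOpen isOpen_Ioi hρ0, mul_assoc (_ * G i)]
  have := hG0 i
  gcongr
  · exact hG i ρ hρ
  · exact hA (n - i) t ht ρ hρ

open FourierTransform in
lemma alphaHat_bound (β : ℝ → ℝ) (hβ : ContDiff ℝ (⊤ : ℕ∞) β)
    (hβsupp : Function.support β ⊆ Icc (1 / 4 : ℝ) 2)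
    (a : ℝ → ℝ → ℂ) (Ck : ℕ → ℝ)
    (hasm : ∀ t ∈ Ici (0 : ℝ), ContDiffOn ℝ (⊤ : ℕ∞) (a t) (Ioi 0))
    (hab : ∀ k : ℕ, ∀ t ∈ Ici (0 : ℝ), ∀ ρ ∈ Ioi (0 : ℝ),
      ‖iteratedDerivWithin k (a t) (Ioi 0) ρ‖ ≤
        Ck k * (1 + phi t * ρ) ^ (-(1 : ℝ) / 6) * ρ ^ (-(k : ℝ))) :
    ∃ M : ℝ, 0 ≤ M ∧ ∀ t, 0 ≤ t → ∀ ξ,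
      ‖alphaHat β a t ξ‖ ≤ M * (1 + phi t) ^ (-(1 : ℝ) / 6) * (1 + ξ ^ 2)⁻¹ := by
  obtain ⟨M0, hM0, h0⟩ := alphaAmp_deriv_bound β hβ hβsupp a Ck hasm hab 0
  obtain ⟨M2, hM2, h2⟩ := alphaAmp_deriv_bound β hβ hβsupp a Ck hasm hab 2
  refine ⟨2 * M0 + 2 * M2, by positivity, ?_⟩
  intro t ht ξ
  have hp := phi_nonneg t ht
  set P := (1 + phi t) ^ (-(1 : ℝ) / 6) with hP
  have hP0 : 0 ≤ P := by positivity
  set f := alphaAmp β a t with hf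
  have hfs : ContDiff ℝ (⊤ : ℕ∞) f := alphaAmp_contDiff β hβ hβsupp a t (hasm t ht)
  have hz : ∀ n ρ, ρ ∉ Icc (1 / 4 : ℝ) 2 → iteratedDeriv n f ρ = 0 :=
    alphaAmp_deriv_zero β hβsupp a t
  have hint : ∀ n : ℕ, Integrable (iteratedDeriv n f) := by
    intro n
    apply (hfs.continuous_iteratedDeriv n (by exact_mod_cast le_top)).integrable_of_hasCompactSupport
    exact HasCompactSupport.intro isCompact_Icc (hz n)
  have hbd : ∀ n : ℕ, ∀ M : ℝ, 0 ≤ M → (∀ ρ, ‖iteratedDeriv n f ρ‖ ≤ M * P) →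
      ∀ x, ‖𝓕 (iteratedDeriv n f) x‖ ≤ 2 * M * P := by
    intro n M hM hb x
    have e1 : ‖𝓕 (iteratedDeriv n f) x‖ ≤ ∫ v, ‖iteratedDeriv n f v‖ :=
      VectorFourier.norm_fourierIntegral_le_integral_norm _ _ _ _ _
    refine e1.trans ?_
    rw [← setIntegral_eq_integral_of_forall_compl_eq_zero (s := Icc (1 / 4 : ℝ) 2)
      (fun ρ hρ => by rw [hz n ρ hρ, norm_zero])]
    have e2 := norm_setIntegral_le_of_norm_le_const (μ := volume) (s := Icc (1 / 4 : ℝ) 2)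
      (f := fun v => ‖iteratedDeriv n f v‖) (C := M * P) (by simp) (fun x _ => by
        rw [norm_norm]; exact hb x)
    refine (le_abs_self _).trans (e2.trans ?_)
    simp only [Measure.real, Real.volume_Icc]
    rw [ENNReal.toReal_ofReal (by norm_num)]
    nlinarith [mul_nonneg hM hP0]
  have hpi : (Real.pi : ℂ) ≠ 0 := by exact_mod_cast Real.pi_ne_zero
  have hhat : alphaHat β a t ξ = 𝓕 f (ξ / (2 * Real.pi)) := by
    rw [Real.fourier_real_eq_integral_exp_smul, alphaHat]
    rw [setIntegral_eq_integral_of_forall_compl_eq_zero]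
    · congr 1
      ext v
      rw [smul_eq_mul]
      congr 2
      push_cast
      field_simp
    · intro ρ hρ
      have := hz 0 ρ (fun h => hρ (by
        have := h.1
        simp only [mem_Ioi]
        linarith))
      rw [iteratedDeriv_zero] at this
      rw [← hf, this, mul_zero]
  have hF := congrFun (Real.fourier_iteratedDeriv (N := ⊤) (n := 2) hfs (fun n _ => hint n) le_top)
    (ξ / (2 * Real.pi))
  have hF2 : 𝓕 (iteratedDeriv 2 f) (ξ / (2 * Real.pi)) = -(ξ ^ 2 : ℝ) * alphaHat β a t ξ := by
    rw [hF, hhat, smul_eq_mul]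
    congr 1
    push_cast
    field_simp
    rw [Complex.I_sq]
    ring
  have b0 := hbd 0 M0 hM0 (h0 t ht) (ξ / (2 * Real.pi))
  have b2 := hbd 2 M2 hM2 (h2 t ht) (ξ / (2 * Real.pi))
  rw [hF2, norm_mul, norm_neg, Complex.norm_real, Real.norm_eq_abs, abs_of_nonneg (sq_nonneg ξ)] at b2
  rw [iteratedDeriv_zero, ← hhat] at b0
  rw [← div_eq_mul_inv, le_div_iff₀ (by positivity)]
  linarith

/-- Stationary-phase bound for circular averages of `α̂_t`: for `r > 1` and `|b| ≤ 2r`,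
`∫₀^{2π} |α̂_t(b - r cos θ)| dθ ≤ C (r^{-1} + r^{-1/2}⟨r - |b|⟩^{-1/2}) (1+φ(t))^{-1/6}`,
with `C` independent of `b`, `r`, `t`. -/
theorem stmt16 (β : ℝ → ℝ) (hβ : ContDiff ℝ (⊤ : ℕ∞) β)
    (hβsupp : Function.support β ⊆ Icc (1 / 4 : ℝ) 2)
    (a : ℝ → ℝ → ℂ) (Ck : ℕ → ℝ)
    (hasm : ∀ t ∈ Ici (0 : ℝ), ContDiffOn ℝ (⊤ : ℕ∞) (a t) (Ioi 0))
    (hab : ∀ k : ℕ, ∀ t ∈ Ici (0 : ℝ), ∀ ρ ∈ Ioi (0 : ℝ),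
      ‖iteratedDerivWithin k (a t) (Ioi 0) ρ‖ ≤
        Ck k * (1 + phi t * ρ) ^ (-(1 : ℝ) / 6) * ρ ^ (-(k : ℝ))) :
    ∃ C > (0 : ℝ), ∀ b r t : ℝ, 1 < r → 0 ≤ t → |b| ≤ 2 * r →
      (∫ θ in Ioo (0 : ℝ) (2 * Real.pi), ‖alphaHat β a t (b - r * Real.cos θ)‖) ≤
        C * (r ^ (-(1 : ℝ)) + r ^ (-(1 : ℝ) / 2) * (1 + abs (r - abs b)) ^ (-(1 : ℝ) / 2)) *
          (1 + phi t) ^ (-(1 : ℝ) / 6) := by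
  obtain ⟨M, hM, hbd⟩ := alphaHat_bound β hβ hβsupp a Ck hasm hab
  refine ⟨(M + 1) * (2 * Real.pi * Real.sqrt 2), by positivity, ?_⟩
  intro b r t hr ht _
  have hp := phi_nonneg t ht
  set P := (1 + phi t) ^ (-(1 : ℝ) / 6) with hP
  have hP0 : 0 ≤ P := by positivity
  have hK := circ_int_bound b r hr
  have hc : Continuous fun θ : ℝ => M * P * (1 + (b - r * Real.cos θ) ^ 2)⁻¹ :=
    continuous_const.mul (Continuous.inv₀ (by fun_prop) (fun θ => by positivity))
  calc (∫ θ in Ioo (0 : ℝ) (2 * Real.pi), ‖alphaHat β a t (b - r * Real.cos θ)‖)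
      ≤ ∫ θ in Ioo (0 : ℝ) (2 * Real.pi), M * P * (1 + (b - r * Real.cos θ) ^ 2)⁻¹ := by
        apply integral_mono_of_nonneg
        · exact Filter.Eventually.of_forall fun θ => norm_nonneg _
        · exact (hc.integrableOn_Icc (a := 0) (b := 2 * Real.pi)).mono_set Ioo_subset_Icc_self
        · exact Filter.Eventually.of_forall fun θ => hbd t ht _
    _ = M * P * ∫ θ in (0 : ℝ)..(2 * Real.pi), (1 + (b - r * Real.cos θ) ^ 2)⁻¹ := by
        rw [integral_const_mul, intervalIntegral.integral_of_le Real.two_pi_pos.le,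
          integral_Ioc_eq_integral_Ioo]
    _ ≤ (M + 1) * P * (2 * Real.pi * Real.sqrt 2 *
          (r ^ (-(1 : ℝ)) + r ^ (-(1 : ℝ) / 2) * (1 + abs (r - abs b)) ^ (-(1 : ℝ) / 2))) := by
        have hr1 : 0 ≤ r ^ (-(1 : ℝ)) := by positivity
        have hE : 0 ≤ r ^ (-(1 : ℝ) / 2) * (1 + abs (r - abs b)) ^ (-(1 : ℝ) / 2) := by positivity
        refine mul_le_mul (by nlinarith) (hK.trans ?_) ?_ (by positivity)
        · gcongr
          linarith
        · apply intervalIntegral.integral_nonneg Real.two_pi_pos.le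
          intro θ _
          positivity
    _ = _ := by ring
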